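/- arXiv:1605.08739 — 2 statements merged into one kernel-verified Lean document; each statement's English description precedes it below -/
import Mathlib

section
/- If u, v ∈ ℤ² are primitive vectors that are adjacent at height h (that is, ‖u‖ ≤ h, ‖v‖ ≤ h, det(u,v) > 0, and no primitive vector w with ‖w‖ ≤ h lies in the open cone between u and v), then ‖u + v‖ > h; consequently ‖v‖ > h − ‖u‖ and ‖u‖ > h − ‖v‖. -/
/-- A vector `u ∈ ℤ²` is primitive if it is nonzero and its coordinates are coprime. -/
def Primitive (u : ℤ × ℤ) : Prop := u ≠ 0 ∧ Int.gcd u.1 u.2 = 1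

/-- The sup norm of a lattice vector, as a natural number. -/
def hgt (u : ℤ × ℤ) : ℕ := max u.1.natAbs u.2.natAbs

/-- The determinant of the `2 × 2` matrix with columns `u` and `v`. -/
def det2 (u v : ℤ × ℤ) : ℤ := u.1 * v.2 - u.2 * v.1

/-- `w` lies in the open cone `{a·u + b·v : a, b ∈ ℝ, a > 0, b > 0}`. -/
def InOpenCone (u v w : ℤ × ℤ) : Prop :=
  ∃ a b : ℝ, 0 < a ∧ 0 < b ∧
    (w.1 : ℝ) = a * u.1 + b * v.1 ∧ (w.2 : ℝ) = a * u.2 + b * v.2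

/-- `u` and `v` are adjacent at height `h`: they span a cone of the complete fan `Σ_h`. -/
def Adjacent (h : ℕ) (u v : ℤ × ℤ) : Prop :=
  hgt u ≤ h ∧ hgt v ≤ h ∧ 0 < det2 u v ∧
    ∀ w : ℤ × ℤ, Primitive w → hgt w ≤ h → ¬ InOpenCone u v w

theorem hgt_add_le (u v : ℤ × ℤ) : hgt (u + v) ≤ hgt u + hgt v := by
  simp only [hgt, Prod.fst_add, Prod.snd_add]
  omega

/-- Every nonzero lattice vector is a positive multiple of a primitive one of no larger height. -/
theorem exists_primitive_of_ne_zero {w : ℤ × ℤ} (hw : w ≠ 0) :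
    ∃ (d : ℕ) (p : ℤ × ℤ), 0 < d ∧ Primitive p ∧ hgt p ≤ hgt w ∧
      w.1 = d * p.1 ∧ w.2 = d * p.2 := by
  have hpos : 0 < Int.gcd w.1 w.2 := by
    rw [Int.gcd_pos_iff]
    by_contra! h
    exact hw (Prod.ext h.1 h.2)
  obtain ⟨a, b, hab, ha, hb⟩ := Int.exists_gcd_one hpos
  refine ⟨Int.gcd w.1 w.2, (a, b), hpos, ⟨?_, hab⟩, ?_, by rw [mul_comm]; exact ha,
    by rw [mul_comm]; exact hb⟩
  · intro h
    obtain ⟨h₁, h₂⟩ := Prod.mk_eq_zero.1 h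
    rw [h₁, h₂, Int.gcd_zero_left] at hab
    exact absurd hab (by decide)
  · have h₁ : a.natAbs ≤ w.1.natAbs := by
      conv_rhs => rw [ha, Int.natAbs_mul, Int.natAbs_natCast]
      exact Nat.le_mul_of_pos_right _ hpos
    have h₂ : b.natAbs ≤ w.2.natAbs := by
      conv_rhs => rw [hb, Int.natAbs_mul, Int.natAbs_natCast]
      exact Nat.le_mul_of_pos_right _ hpos
    exact max_le_max h₁ h₂

theorem add_ne_zero_of_det2_pos {u v : ℤ × ℤ} (h : 0 < det2 u v) : u + v ≠ 0 := by
  intro h0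
  rw [← eq_neg_iff_add_eq_zero] at h0
  subst h0
  simp only [det2, Prod.fst_neg, Prod.snd_neg] at h
  linarith

theorem Adjacent.lt_hgt_add {h : ℕ} {u v : ℤ × ℤ} (hadj : Adjacent h u v) :
    h < hgt (u + v) := by
  obtain ⟨-, -, hdet, hcone⟩ := hadj
  by_contra! hle
  obtain ⟨d, p, hd, hp, hpw, h₁, h₂⟩ :=
    exists_primitive_of_ne_zero (add_ne_zero_of_det2_pos hdet)
  have hd' : (0 : ℝ) < d := by exact_mod_cast hd
  refine hcone p hp (hpw.trans hle) ⟨(d : ℝ)⁻¹, (d : ℝ)⁻¹, by positivity, by positivity, ?_, ?_⟩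
  · have : (u.1 : ℝ) + v.1 = d * p.1 := by exact_mod_cast h₁
    rw [← mul_add, this, inv_mul_cancel_left₀ hd'.ne']
  · have : (u.2 : ℝ) + v.2 = d * p.2 := by exact_mod_cast h₂
    rw [← mul_add, this, inv_mul_cancel_left₀ hd'.ne']

/-- If `u` and `v` are adjacent at height `h`, then `‖u + v‖ > h`; consequently
`‖v‖ > h − ‖u‖` and `‖u‖ > h − ‖v‖`. -/
theorem neighbor_height_bound (h : ℕ) (u v : ℤ × ℤ)
    (hu : Primitive u) (hv : Primitive v) (hadj : Adjacent h u v) :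
    h < hgt (u + v) ∧ h - hgt u < hgt v ∧ h - hgt v < hgt u := by
  have hsum := hadj.lt_hgt_add
  have htri := hgt_add_le u v
  obtain ⟨hu', hv', -, -⟩ := hadj
  exact ⟨hsum, by omega, by omega⟩
end

section
/- Main Theorem, part 1 (smoothness threshold): Let q : ℕ → ℝ with 0 ≤ q(h) ≤ 1 for all h. If h²·q(h) → 0 as h → ∞, or h²·(1 − q(h)) → 0 as h → ∞, then P_{h,1−q(h)}({S ⊆ R_h : S is smooth}) → 1 as h → ∞. That is, with high probability the toric surface of a random fan drawn from T(h, 1 − q(h)) is smooth. -/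
open Filter Topology

open Classical in
/-- The set of primitive vectors of sup norm at most `h` (the rays of the complete fan `Σ_h`). -/
noncomputable def rays (h : ℕ) : Finset (ℤ × ℤ) :=
  (Finset.Icc (-(h : ℤ), -(h : ℤ)) ((h : ℤ), (h : ℤ))).filter (fun u => Primitive u)

/-- `u` and `v` are `S`-adjacent: both lie in `S`, `det(u,v) > 0`, and no element of `S`
lies in the open cone between them.  `S`-adjacent pairs span the 2-dimensional cones of
the completed fan of `S`. -/
def SAdj (S : Finset (ℤ × ℤ)) (u v : ℤ × ℤ) : Prop :=
  u ∈ S ∧ v ∈ S ∧ 0 < det2 u v ∧ ∀ w ∈ S, ¬ InOpenCone u v w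

open Classical in
/-- The probability, under the distribution `T(h, p)` (each ray of `Σ_h` kept
independently with probability `p`), of the set of fans whose ray set satisfies `A`. -/
noncomputable def prob (h : ℕ) (p : ℝ) (A : Finset (ℤ × ℤ) → Prop) : ℝ :=
  ∑ S ∈ (rays h).powerset,
    if A S then p ^ S.card * (1 - p) ^ ((rays h).card - S.card) else 0

/-- Given primitive `u, v` with `det2 u v > 1` in a sup-norm ball, there is `w` in that ball with
`det2 u w = 1` lying in the open cone spanned by `u` and `v`. -/
lemma exists_lattice_point_in_cone {u v : ℤ × ℤ} {h : ℤ} (hu : Primitive u) (hv : Primitive v)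
    (hu1 : |u.1| ≤ h) (hu2 : |u.2| ≤ h) (hv1 : |v.1| ≤ h) (hv2 : |v.2| ≤ h)
    (hd : 1 < det2 u v) :
    ∃ w : ℤ × ℤ, det2 u w = 1 ∧ |w.1| ≤ h ∧ |w.2| ≤ h ∧ InOpenCone u v w := by
  obtain ⟨a, b⟩ := u
  obtain ⟨c, e⟩ := v
  obtain ⟨-, hu⟩ := hu
  obtain ⟨-, hv⟩ := hv
  simp only [det2] at *
  obtain ⟨s, t, hst⟩ := Int.isCoprime_iff_gcd_eq_one.2 hu
  set d := a * e - b * c with hd_def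
  have h1 : (s * c + t * e) * a - d * t = c := by rw [hd_def]; linear_combination c * hst
  have h2 : (s * c + t * e) * b + d * s = e := by rw [hd_def]; linear_combination e * hst
  set α := s * c + t * e
  have hα : ¬ d ∣ α := by
    intro hα
    have hc : d ∣ c := h1 ▸ dvd_sub (hα.mul_right a) (dvd_mul_right d t)
    have he : d ∣ e := h2 ▸ dvd_add (hα.mul_right b) (dvd_mul_right d s)
    have hg : d ∣ 1 := by
      have := Int.dvd_coe_gcd hc he
      rwa [hv] at this
    have := Int.le_of_dvd one_pos hg
    omega
  set k := (-α) / d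
  set r := (-α) % d with hr
  have hkr : d * k + r = -α := Int.mul_ediv_add_emod _ _
  have hr0 : 0 < r := by
    refine lt_of_le_of_ne (Int.emod_nonneg _ (by omega)) fun h0 => hα ?_
    exact (Int.dvd_neg).1 (Int.dvd_of_emod_eq_zero h0.symm)
  have hrd : r < d := Int.emod_lt_of_pos _ (by omega)
  have hw1 : d * (-t - k * a) = r * a + c := by linear_combination h1 - a * hkr
  have hw2 : d * (s - k * b) = r * b + e := by linear_combination h2 - b * hkr
  have bound : ∀ x y w : ℤ, |x| ≤ h → |y| ≤ h → d * w = r * x + y → |w| ≤ h := by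
    intro x y w hx hy hw
    have hh : 0 ≤ h := (abs_nonneg x).trans hx
    have h3 : d * |w| ≤ r * h + h := by
      calc d * |w| = |r * x + y| := by rw [← hw, abs_mul, abs_of_pos (by omega : 0 < d)]
        _ ≤ |r * x| + |y| := abs_add_le _ _
        _ = r * |x| + |y| := by rw [abs_mul, abs_of_pos hr0]
        _ ≤ r * h + h := by gcongr
    have h4 : r * h + h ≤ d * h := by nlinarith
    exact le_of_mul_le_mul_left (h3.trans h4) (by omega)
  refine ⟨(-t - k * a, s - k * b), by linear_combination hst, bound _ _ _ hu1 hv1 hw1,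
    bound _ _ _ hu2 hv2 hw2, (r : ℝ) / d, 1 / (d : ℝ), ?_, ?_, ?_, ?_⟩
  · have : (0 : ℝ) < r := by exact_mod_cast hr0
    have : (0 : ℝ) < d := by exact_mod_cast (by omega : 0 < d)
    positivity
  · have : (0 : ℝ) < d := by exact_mod_cast (by omega : 0 < d)
    positivity
  · have hd0 : (d : ℝ) ≠ 0 := by exact_mod_cast (by omega : d ≠ 0)
    have : (d : ℝ) * ((-t - k * a : ℤ) : ℝ) = r * a + c := by exact_mod_cast hw1
    field_simp
    linear_combination this
  · have hd0 : (d : ℝ) ≠ 0 := by exact_mod_cast (by omega : d ≠ 0)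
    have : (d : ℝ) * ((s - k * b : ℤ) : ℝ) = r * b + e := by exact_mod_cast hw2
    field_simp
    linear_combination this

lemma mem_rays {h : ℕ} {u : ℤ × ℤ} :
    u ∈ rays h ↔ |u.1| ≤ (h : ℤ) ∧ |u.2| ≤ (h : ℤ) ∧ Primitive u := by
  simp only [rays, Finset.mem_filter, Finset.mem_Icc, Prod.le_def, abs_le]
  tauto

lemma primitive_of_det2_eq_one {u w : ℤ × ℤ} (h : det2 u w = 1) : Primitive w := by
  have hcop : IsCoprime w.1 w.2 := ⟨-u.2, u.1, by rw [det2] at h; linear_combination h⟩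
  refine ⟨?_, Int.isCoprime_iff_gcd_eq_one.1 hcop⟩
  rintro rfl
  simp [det2] at h

/-- The complete fan on all primitive vectors of norm at most `h` is smooth. -/
lemma rays_smooth (h : ℕ) (u v : ℤ × ℤ) (huv : SAdj (rays h) u v) : det2 u v = 1 := by
  obtain ⟨hu, hv, hpos, hcone⟩ := huv
  rw [mem_rays] at hu hv
  by_contra hne
  obtain ⟨w, hw, hw1, hw2, hwc⟩ := exists_lattice_point_in_cone hu.2.2 hv.2.2 hu.1 hu.2.1
    hv.1 hv.2.1 (by omega)
  exact hcone w (mem_rays.2 ⟨hw1, hw2, primitive_of_det2_eq_one hw⟩) hwc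

lemma card_rays_le (h : ℕ) : (rays h).card ≤ (2 * h + 1) ^ 2 := by
  classical
  have hsub : rays h ⊆ Finset.Icc (-(h : ℤ), -(h : ℤ)) ((h : ℤ), (h : ℤ)) := by
    rw [rays]
    exact Finset.filter_subset _ _
  refine (Finset.card_le_card hsub).trans (le_of_eq ?_)
  rw [← Finset.Icc_product_Icc]
  simp only [Finset.card_product, Int.card_Icc]
  have : ((h : ℤ) + 1 - -(h : ℤ)).toNat = 2 * h + 1 := by omega
  rw [this, sq]

lemma prob_le_one {h : ℕ} {p : ℝ} (hp0 : 0 ≤ p) (hp1 : p ≤ 1) (A : Finset (ℤ × ℤ) → Prop) :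
    prob h p A ≤ 1 := by
  have hp : 0 ≤ 1 - p := sub_nonneg.2 hp1
  calc prob h p A
      ≤ ∑ S ∈ (rays h).powerset, p ^ S.card * (1 - p) ^ ((rays h).card - S.card) := by
        refine Finset.sum_le_sum fun S _ => ?_
        split_ifs
        · exact le_rfl
        · positivity
    _ = 1 := by rw [Finset.sum_pow_mul_eq_add_pow]; simp

lemma weight_le_prob {h : ℕ} {p : ℝ} (hp0 : 0 ≤ p) (hp1 : p ≤ 1) {A : Finset (ℤ × ℤ) → Prop}
    {S : Finset (ℤ × ℤ)} (hS : S ⊆ rays h) (hA : A S) :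
    p ^ S.card * (1 - p) ^ ((rays h).card - S.card) ≤ prob h p A := by
  have hp : 0 ≤ 1 - p := sub_nonneg.2 hp1
  rw [prob]
  refine le_trans ?_ (Finset.single_le_sum (fun T _ => ?_) (Finset.mem_powerset.2 hS))
  · rw [if_pos hA]
  · split_ifs <;> positivity

/-- A Bernoulli-type bound: `(1 - x) ^ N_h ≥ 1 - 9 h² x` for `h ≥ 1`. -/
lemma one_sub_le_pow_card_rays {h : ℕ} (hh : 1 ≤ h) {x : ℝ} (hx0 : 0 ≤ x) (hx1 : x ≤ 1) :
    1 - 9 * ((h : ℝ) ^ 2 * x) ≤ (1 - x) ^ (rays h).card := by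
  have h1 := one_add_mul_le_pow (a := -x) (by linarith) (rays h).card
  have h2 : ((rays h).card : ℝ) ≤ (2 * h + 1) ^ 2 := by exact_mod_cast card_rays_le h
  have h3 : (1 : ℝ) ≤ h := by exact_mod_cast hh
  have h4 : ((rays h).card : ℝ) ≤ 9 * (h : ℝ) ^ 2 := by nlinarith
  have h5 := mul_le_mul_of_nonneg_right h4 hx0
  rw [sub_eq_add_neg 1 x]
  linarith

/-- Main Theorem, part 1 (smoothness threshold): if `h²·q(h) → 0` or
`h²·(1 − q(h)) → 0`, then with high probability a random fan from `T(h, 1 − q(h))`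
gives a smooth toric surface. -/
theorem smooth_threshold (q : ℕ → ℝ) (hq : ∀ h, 0 ≤ q h ∧ q h ≤ 1)
    (hor : Tendsto (fun h : ℕ => (h : ℝ) ^ 2 * q h) atTop (nhds 0) ∨
      Tendsto (fun h : ℕ => (h : ℝ) ^ 2 * (1 - q h)) atTop (nhds 0)) :
    Tendsto (fun h : ℕ =>
        prob h (1 - q h) (fun S => ∀ u v : ℤ × ℤ, SAdj S u v → det2 u v = 1))
      atTop (nhds 1) := by
  have key : ∀ x : ℕ → ℝ, (∀ h, 0 ≤ x h ∧ x h ≤ 1) →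
      Tendsto (fun h : ℕ => (h : ℝ) ^ 2 * x h) atTop (nhds 0) →
      (∀ h, (1 - x h) ^ (rays h).card ≤
        prob h (1 - q h) (fun S => ∀ u v : ℤ × ℤ, SAdj S u v → det2 u v = 1)) →
      Tendsto (fun h : ℕ =>
        prob h (1 - q h) (fun S => ∀ u v : ℤ × ℤ, SAdj S u v → det2 u v = 1))
        atTop (nhds 1) := by
    intro x hx hlim hle
    have hlow : Tendsto (fun h : ℕ => 1 - 9 * ((h : ℝ) ^ 2 * x h)) atTop (nhds 1) := by
      simpa using (hlim.const_mul 9).const_sub 1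
    refine tendsto_of_tendsto_of_tendsto_of_le_of_le' hlow tendsto_const_nhds ?_
      (Eventually.of_forall fun h => prob_le_one (by linarith [hq h]) (by linarith [hq h]) _)
    filter_upwards [eventually_ge_atTop 1] with h hh
    exact (one_sub_le_pow_card_rays hh (hx h).1 (hx h).2).trans (hle h)
  rcases hor with hor | hor
  · refine key q hq hor fun h => ?_
    simpa using weight_le_prob (h := h) (p := 1 - q h)
      (A := fun S => ∀ u v : ℤ × ℤ, SAdj S u v → det2 u v = 1) (by linarith [hq h])
      (by linarith [hq h]) (Finset.Subset.refl _) (rays_smooth h)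
  · refine key (fun h => 1 - q h) (fun h => ⟨by linarith [hq h], by linarith [hq h]⟩) hor
      fun h => ?_
    simpa using weight_le_prob (h := h) (p := 1 - q h)
      (A := fun S => ∀ u v : ℤ × ℤ, SAdj S u v → det2 u v = 1) (by linarith [hq h])
      (by linarith [hq h]) (Finset.empty_subset _) (fun u v huv => by simp [SAdj] at huv)
end
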